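/- arXiv:2411.01068 — 14 statements merged into one kernel-verified Lean document; each statement's English description precedes it below -/
import Mathlib

section
/- For every prize schedule v ∈ 𝒱, the psychological marginal benefit satisfies L(v) = Σ_{r=1}^{n−1} (2r/n − 1) B_r d_r. -/
open Finset

/-- Abel summation for weights `a + β s` against the differences `v s - v (m + 1)`. -/
lemma sum_add_mul_sub_eq_sum_partial_sums (β v : ℕ → ℝ) (a : ℝ) (m : ℕ) :
    ∑ s ∈ Icc 1 m, (a + β s) * (v s - v (m + 1))
      = ∑ r ∈ Icc 1 m, (∑ k ∈ Icc 1 r, β k + r * a) * (v r - v (r + 1)) := by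
  have weights (m : ℕ) : ∑ s ∈ Icc 1 m, (a + β s) = ∑ k ∈ Icc 1 m, β k + m * a := by
    simp [sum_add_distrib, add_comm]
  induction m with
  | zero => simp
  | succ m ih =>
    have split : ∑ s ∈ Icc 1 (m + 1), (a + β s) * (v s - v (m + 1 + 1))
        = ∑ s ∈ Icc 1 (m + 1), (a + β s) * (v s - v (m + 1))
          + (∑ s ∈ Icc 1 (m + 1), (a + β s)) * (v (m + 1) - v (m + 1 + 1)) := by
      rw [sum_mul, ← sum_add_distrib]
      exact sum_congr rfl fun s _ => by ring
    rw [split, weights, sum_Icc_succ_top (by omega), ih,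
      sum_Icc_succ_top (by omega : 1 ≤ m + 1)
        (fun r : ℕ => (∑ k ∈ Icc 1 r, β k + r * a) * (v r - v (r + 1)))]
    ring

/-- The pairwise sum expressed through partial sums, without assuming that `β` sums to zero. -/
lemma sum_pairs_add_mul_sub_eq_sum_partial_sums (β v : ℕ → ℝ) (m : ℕ) :
    ∑ r ∈ Icc 1 (m + 1), ∑ s ∈ Ico 1 r, (β r + β s) * (v s - v r)
      = ∑ r ∈ Icc 1 m, (((m : ℝ) + 1 - 2 * r) * ∑ k ∈ Icc 1 r, β k
          + r * ∑ k ∈ Icc 1 (m + 1), β k) * (v r - v (r + 1)) := by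
  induction m with
  | zero => simp
  | succ m ih =>
    have inner := sum_add_mul_sub_eq_sum_partial_sums β v (β (m + 1 + 1)) (m + 1)
    rw [sum_Icc_succ_top (by omega), ih, Ico_add_one_right_eq_Icc, inner,
      sum_Icc_succ_top (by omega : 1 ≤ m + 1)
        (fun r : ℕ => (∑ k ∈ Icc 1 r, β k + r * β (m + 1 + 1)) * (v r - v (r + 1))),
      sum_Icc_succ_top (by omega : 1 ≤ m + 1)
        (fun r : ℕ => ((((m + 1 : ℕ) : ℝ) + 1 - 2 * r) * ∑ k ∈ Icc 1 r, β k
          + r * ∑ k ∈ Icc 1 (m + 1 + 1), β k) * (v r - v (r + 1))),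
      ← add_assoc, ← sum_add_distrib, sum_Icc_succ_top (by omega : 1 ≤ m + 1 + 1) β]
    congr 1
    · refine sum_congr rfl fun r _ => ?_
      push_cast
      ring
    · push_cast
      ring

/-- Lemma 1 representation of the psychological marginal benefit.
Fix `n ≥ 2` and reals `β 1, …, β n` summing to zero, with partial sums `B`.
For every prize schedule `v ∈ 𝒱` (decreasing, nonnegative, summing to one),
the psychological marginal benefit satisfies
`L(v) = ∑_{r=1}^{n-1} (2r/n − 1) B_r d_r`, where `d_r = v_r − v_{r+1}`. -/
theorem psychological_marginal_benefit_representation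
    (n : ℕ) (hn : 2 ≤ n) (β : ℕ → ℝ)
    (hβsum : ∑ r ∈ Icc 1 n, β r = 0)
    (B : ℕ → ℝ) (hB : ∀ r, B r = ∑ k ∈ Icc 1 r, β k)
    (v : ℕ → ℝ)
    (hmono : ∀ r ∈ Icc 1 (n - 1), v (r + 1) ≤ v r)
    (hnonneg : ∀ r ∈ Icc 1 n, 0 ≤ v r)
    (hvsum : ∑ r ∈ Icc 1 n, v r = 1) :
    -(1 / (n : ℝ)) * ∑ r ∈ Icc 1 n, ∑ s ∈ Ico 1 r, (β r + β s) * (v s - v r)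
      = ∑ r ∈ Icc 1 (n - 1), (2 * (r : ℝ) / n - 1) * B r * (v r - v (r + 1)) := by
  obtain ⟨m, rfl⟩ : ∃ m, n = m + 1 := ⟨n - 1, by omega⟩
  rw [sum_pairs_add_mul_sub_eq_sum_partial_sums, hβsum, mul_sum, Nat.add_sub_cancel]
  refine sum_congr rfl fun r _ => ?_
  have hm : (m : ℝ) + 1 ≠ 0 := by positivity
  rw [hB]
  push_cast
  field_simp
  ring
end

section
/- Suppose B_r > 0 for all 1 ≤ r ≤ n−1. Let v ∈ 𝒱 satisfy v_r = 0 for all r > ⌊n/2⌋ (at most ⌊n/2⌋ positive prizes). Then L(v) ≤ 0; consequently, for any strictly increasing function g : ℝ → ℝ and any 0 ≤ θ < θ′ ≤ 1, if x and x′ satisfy g(x) = M(v,θ) and g(x′) = M(v,θ′), then x′ ≤ x (the equilibrium effort decreases with loss aversion). -/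
open Finset

theorem sum_Icc_mul_sub_succ {β B v : ℕ → ℝ} (hB0 : B 0 = 0)
    (hB : ∀ m, B (m + 1) = B m + β (m + 1)) (b : ℝ) (m : ℕ) :
    ∑ s ∈ Icc 1 m, (b + β s) * (v s - v (m + 1)) =
      ∑ k ∈ Icc 1 m, (v k - v (k + 1)) * (k * b + B k) := by
  have hsum (m : ℕ) : ∑ s ∈ Icc 1 m, (b + β s) = m * b + B m := by
    induction m with
    | zero => simp [hB0]
    | succ m ih =>
      rw [sum_Icc_succ_top (by omega), ih, hB]
      push_cast
      ring
  induction m with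
  | zero => simp
  | succ m ih =>
    have h : ∑ s ∈ Icc 1 (m + 1), (b + β s) * (v s - v (m + 1 + 1)) =
        ∑ s ∈ Icc 1 (m + 1), (b + β s) * (v s - v (m + 1)) +
          (∑ s ∈ Icc 1 (m + 1), (b + β s)) * (v (m + 1) - v (m + 1 + 1)) := by
      rw [sum_mul, ← sum_add_distrib]
      exact sum_congr rfl fun s _ => by ring
    rw [h, hsum, sum_Icc_succ_top (by omega), ih, sum_Icc_succ_top (by omega)]
    ring

theorem sum_pairs_mul_sub {β B v : ℕ → ℝ} (hB0 : B 0 = 0)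
    (hB : ∀ m, B (m + 1) = B m + β (m + 1)) (m : ℕ) :
    ∑ r ∈ Icc 1 m, ∑ s ∈ Ico 1 r, (β r + β s) * (v s - v r) =
      ∑ k ∈ Icc 1 m, (v k - v (k + 1)) * (k * (B m - B k) + (m - k) * B k) := by
  induction m with
  | zero => simp
  | succ m ih =>
    have hI : Ico 1 (m + 1) = Icc 1 m := by
      ext
      simp only [mem_Ico, mem_Icc]
      omega
    rw [sum_Icc_succ_top (by omega), ih, hI, sum_Icc_mul_sub_succ hB0 hB,
      ← sum_add_distrib, sum_Icc_succ_top (by omega)]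
    simp only [sub_self, mul_zero, zero_mul, add_zero]
    refine sum_congr rfl fun k _ => ?_
    rw [hB]
    push_cast
    ring

/-- effort decreases with loss aversion when at most `⌊n/2⌋` prizes
are positive. Suppose `B r > 0` for `1 ≤ r ≤ n − 1` and the prize schedule `v ∈ 𝒱`
satisfies `v r = 0` for all `r > ⌊n/2⌋`. Then `L(v) ≤ 0`; consequently, for any
strictly increasing `g` and `0 ≤ θ < θ' ≤ 1`, if `g x = M(v,θ)` and `g x' = M(v,θ')`
then `x' ≤ x`. -/
theorem effort_decreases_few_positive_prizes
    (n : ℕ) (hn : 2 ≤ n) (β : ℕ → ℝ)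
    (hβsum : ∑ r ∈ Icc 1 n, β r = 0)
    (B : ℕ → ℝ) (hB : ∀ r, B r = ∑ k ∈ Icc 1 r, β k)
    (hBpos : ∀ r ∈ Icc 1 (n - 1), 0 < B r)
    (v : ℕ → ℝ)
    (hmono : ∀ r ∈ Icc 1 (n - 1), v (r + 1) ≤ v r)
    (hnonneg : ∀ r ∈ Icc 1 n, 0 ≤ v r)
    (hvsum : ∑ r ∈ Icc 1 n, v r = 1)
    (hzero : ∀ r ∈ Icc 1 n, n / 2 < r → v r = 0)
    (L : ℝ)
    (hL : L = -(1 / (n : ℝ)) * ∑ r ∈ Icc 1 n, ∑ s ∈ Ico 1 r, (β r + β s) * (v s - v r))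
    (R : ℝ) (hR : R = ∑ r ∈ Icc 1 n, β r * v r)
    (M : ℝ → ℝ) (hM : ∀ θ, M θ = R + θ * L) :
    L ≤ 0 ∧
      ∀ g : ℝ → ℝ, StrictMono g → ∀ θ θ' x x', 0 ≤ θ → θ < θ' → θ' ≤ 1 →
        g x = M θ → g x' = M θ' → x' ≤ x := by
  have hB0 : B 0 = 0 := by simp [hB]
  have hBs (m : ℕ) : B (m + 1) = B m + β (m + 1) := by
    rw [hB, hB, sum_Icc_succ_top (by omega)]
  have hBn : B n = 0 := by rw [hB, hβsum]
  have hL0 : L ≤ 0 := by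
    rw [hL, sum_pairs_mul_sub hB0 hBs, neg_mul]
    refine neg_nonpos.2 (mul_nonneg (by positivity) (sum_nonneg fun k hk => ?_))
    obtain ⟨h1, hkn⟩ := mem_Icc.1 hk
    rcases hkn.eq_or_lt with rfl | hlt
    · simp [hBn]
    · have hk' : k ∈ Icc 1 (n - 1) := mem_Icc.2 ⟨h1, by omega⟩
      rcases le_or_gt k (n / 2) with h2 | h2
      · have h3 : (2 * k : ℝ) ≤ n := by exact_mod_cast (by omega : 2 * k ≤ n)
        have hcoef : (k : ℝ) * (B n - B k) + (n - k) * B k = (n - 2 * k) * B k := by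
          rw [hBn]
          ring
        rw [hcoef]
        exact mul_nonneg (sub_nonneg.2 (hmono k hk'))
          (mul_nonneg (sub_nonneg.2 h3) (hBpos k hk').le)
      · rw [hzero k hk h2, hzero (k + 1) (mem_Icc.2 ⟨by omega, hlt⟩) (by omega)]
        simp
  refine ⟨hL0, fun g hg θ θ' x x' _ hθ _ hx hx' => hg.le_iff_le.1 ?_⟩
  rw [hx, hx', hM, hM]
  have := mul_le_mul_of_nonpos_right hθ.le hL0
  linarith
end

section
/- For 1 ≤ s ≤ n−1, the prize schedule v^s awarding s equal prizes satisfies L(v^s) = (2s/n − 1)·B_s/s. Consequently, if B_s > 0, then for any strictly increasing function g : ℝ → ℝ and any 0 ≤ θ < θ′ ≤ 1, with g(x) = M(v^s,θ) and g(x′) = M(v^s,θ′): if s < n/2 then x′ < x, and if s > n/2 then x′ > x. -/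
open Finset

/-- The sum over pairs `t < r` separated by the threshold `s`, where the prize gap is `1 / s`
if `t ≤ s < r` and zero otherwise. -/
lemma sum_pairs_mul_equal_prize_gap (β v : ℕ → ℝ) {s : ℕ} (hs : 1 ≤ s)
    (hv : ∀ r, v r = if r ≤ s then 1 / (s : ℝ) else 0) {m : ℕ} (hm : s ≤ m) :
    ∑ r ∈ Icc 1 m, ∑ t ∈ Ico 1 r, (β r + β t) * (v t - v r) =
      ∑ r ∈ Icc 1 m, β r - ∑ r ∈ Icc 1 s, β r
        + ((m : ℝ) - s) * (∑ r ∈ Icc 1 s, β r) / s := by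
  have hs0 : (s : ℝ) ≠ 0 := by positivity
  induction m, hm using Nat.le_induction with
  | base =>
    rw [sum_eq_zero]
    · simp
    · intro r hr
      refine sum_eq_zero fun t ht => ?_
      rw [mem_Icc] at hr
      rw [mem_Ico] at ht
      rw [hv, hv, if_pos hr.2, if_pos (by omega), sub_self, mul_zero]
  | succ m hm ih =>
    have inner : ∑ t ∈ Ico 1 (m + 1), (β (m + 1) + β t) * (v t - v (m + 1)) =
        β (m + 1) + (∑ r ∈ Icc 1 s, β r) / s := by
      have hsub : Icc 1 s ⊆ Ico 1 (m + 1) := fun t ht => by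
        rw [mem_Icc] at ht
        rw [mem_Ico]
        omega
      rw [← sum_subset hsub]
      · have hterm : ∀ t ∈ Icc 1 s, (β (m + 1) + β t) * (v t - v (m + 1)) =
            (β (m + 1) + β t) / s := fun t ht => by
          rw [hv, hv, if_pos (mem_Icc.1 ht).2, if_neg (by omega)]
          ring
        rw [sum_congr rfl hterm, ← sum_div, sum_add_distrib, sum_const, Nat.card_Icc,
          Nat.add_sub_cancel, nsmul_eq_mul]
        field_simp
      · intro t ht hts
        rw [mem_Ico] at ht
        rw [mem_Icc] at hts
        rw [hv, hv, if_neg (by omega), if_neg (by omega), sub_self, mul_zero]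
    rw [sum_Icc_succ_top (by omega), sum_Icc_succ_top (by omega), ih, inner]
    push_cast
    ring

/-- Corollary 1. For `1 ≤ s ≤ n − 1`, the prize schedule `v^s`
awarding `s` equal prizes satisfies `L(v^s) = (2s/n − 1)·B_s/s`. Consequently, if
`B_s > 0`, then for any strictly increasing `g` and `0 ≤ θ < θ' ≤ 1`, with
`g x = M(v^s,θ)` and `g x' = M(v^s,θ')`: if `s < n/2` then `x' < x`, and if
`s > n/2` then `x' > x`. -/
theorem equal_prize_schedule_loss_aversion
    (n : ℕ) (hn : 2 ≤ n) (β : ℕ → ℝ)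
    (hβsum : ∑ r ∈ Icc 1 n, β r = 0)
    (B : ℕ → ℝ) (hB : ∀ r, B r = ∑ k ∈ Icc 1 r, β k)
    (s : ℕ) (hs1 : 1 ≤ s) (hs2 : s ≤ n - 1)
    (v : ℕ → ℝ) (hv : ∀ r, v r = if r ≤ s then 1 / (s : ℝ) else 0)
    (L : ℝ)
    (hL : L = -(1 / (n : ℝ)) * ∑ r ∈ Icc 1 n, ∑ t ∈ Ico 1 r, (β r + β t) * (v t - v r))
    (R : ℝ) (hR : R = ∑ r ∈ Icc 1 n, β r * v r)
    (M : ℝ → ℝ) (hM : ∀ θ, M θ = R + θ * L) :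
    L = (2 * (s : ℝ) / n - 1) * B s / s ∧
      (0 < B s →
        ∀ g : ℝ → ℝ, StrictMono g → ∀ θ θ' x x', 0 ≤ θ → θ < θ' → θ' ≤ 1 →
          g x = M θ → g x' = M θ' →
          (((s : ℝ) < (n : ℝ) / 2 → x' < x) ∧ ((n : ℝ) / 2 < (s : ℝ) → x < x'))) := by
  have hn0 : (0 : ℝ) < n := by positivity
  have hs0 : (0 : ℝ) < s := by positivity
  have hLval : L = (2 * (s : ℝ) / n - 1) * B s / s := by
    rw [hL, sum_pairs_mul_equal_prize_gap β v hs1 hv (by omega : s ≤ n), hβsum, ← hB]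
    field_simp
    ring
  refine ⟨hLval, fun hBs g hg θ θ' x x' _ hθ _ hx hx' => ⟨fun hs => ?_, fun hs => ?_⟩⟩
  · have hneg : L < 0 := by
      have hcoef : 2 * (s : ℝ) / n - 1 < 0 := by
        rw [sub_neg, div_lt_one hn0]
        linarith
      rw [hLval]
      exact div_neg_of_neg_of_pos (mul_neg_of_neg_of_pos hcoef hBs) hs0
    rw [← hg.lt_iff_lt, hx, hx', hM, hM]
    linarith [mul_lt_mul_of_neg_right hθ hneg]
  · have hpos : 0 < L := by
      have hcoef : 0 < 2 * (s : ℝ) / n - 1 := by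
        rw [sub_pos, one_lt_div hn0]
        linarith
      rw [hLval]
      exact div_pos (mul_pos hcoef hBs) hs0
    rw [← hg.lt_iff_lt, hx, hx', hM, hM]
    linarith [mul_lt_mul_of_pos_right hθ hpos]
end

section
/- Suppose B_r > 0 for all 1 ≤ r ≤ n−1. Then for every θ ∈ [0,1], sup_{v ∈ 𝒱} M(v,θ) = max_{1 ≤ r ≤ n−1} A_r(θ); moreover, for any r* maximizing A_r(θ) over 1 ≤ r ≤ n−1, the prize schedule v^{r*} awarding r* equal prizes at the top attains this supremum, i.e., M(v^{r*},θ) = max_{1 ≤ r ≤ n−1} A_r(θ). -/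
open Finset

theorem sum_mul_sub_eq_sum_partialSum_mul_sub (c v : ℕ → ℝ) (m : ℕ) :
    ∑ s ∈ Icc 1 m, c s * (v s - v (m + 1)) =
      ∑ k ∈ Icc 1 m, (∑ s ∈ Icc 1 k, c s) * (v k - v (k + 1)) := by
  induction m with
  | zero => simp
  | succ m ih =>
    rw [sum_Icc_succ_top (by omega) (fun k => (∑ s ∈ Icc 1 k, c s) * (v k - v (k + 1))), ← ih,
      sum_mul, sum_Icc_succ_top (by omega), sum_Icc_succ_top (by omega), ← add_assoc,
      ← sum_add_distrib]
    congr 1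
    exact sum_congr rfl fun s _ => by ring

theorem sum_sum_add_mul_sub (β v : ℕ → ℝ) (m : ℕ) :
    ∑ r ∈ Icc 1 (m + 1), ∑ s ∈ Ico 1 r, (β r + β s) * (v s - v r) =
      ∑ k ∈ Icc 1 m, (k * (∑ s ∈ Icc 1 (m + 1), β s - ∑ s ∈ Icc 1 k, β s) +
        (m + 1 - k) * ∑ s ∈ Icc 1 k, β s) * (v k - v (k + 1)) := by
  induction m with
  | zero => simp
  | succ m ih =>
    have hlast : ∑ k ∈ Icc 1 m, (k * (∑ s ∈ Icc 1 (m + 1), β s - ∑ s ∈ Icc 1 k, β s) +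
          (m + 1 - k) * ∑ s ∈ Icc 1 k, β s) * (v k - v (k + 1)) =
        ∑ k ∈ Icc 1 (m + 1), (k * (∑ s ∈ Icc 1 (m + 1), β s - ∑ s ∈ Icc 1 k, β s) +
          (m + 1 - k) * ∑ s ∈ Icc 1 k, β s) * (v k - v (k + 1)) := by
      refine .trans ?_ (sum_Icc_succ_top (by omega) _).symm
      simp
    rw [sum_Icc_succ_top (by omega), ih, hlast, Ico_add_one_right_eq_Icc,
      sum_mul_sub_eq_sum_partialSum_mul_sub (fun s => β (m + 1 + 1) + β s), ← sum_add_distrib]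
    refine sum_congr rfl fun k _ => ?_
    rw [sum_Icc_succ_top (b := m + 1) (by omega) β, sum_add_distrib, sum_const, Nat.card_Icc,
      nsmul_eq_mul, Nat.add_sub_cancel]
    push_cast
    ring

theorem sum_mul_add_loss_eq (β v : ℕ → ℝ) (m : ℕ) (θ : ℝ) (hβ : ∑ r ∈ Icc 1 (m + 1), β r = 0) :
    (∑ r ∈ Icc 1 (m + 1), β r * v r) + θ * (-(1 / ((m + 1 : ℕ) : ℝ)) *
      ∑ r ∈ Icc 1 (m + 1), ∑ s ∈ Ico 1 r, (β r + β s) * (v s - v r)) =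
    ∑ k ∈ Icc 1 m, (1 + θ * (2 * (k : ℝ) / (m + 1 : ℕ) - 1)) * (∑ s ∈ Icc 1 k, β s) *
      (v k - v (k + 1)) := by
  have hR : ∑ r ∈ Icc 1 (m + 1), β r * v r =
      ∑ k ∈ Icc 1 m, (∑ s ∈ Icc 1 k, β s) * (v k - v (k + 1)) := by
    rw [← sum_mul_sub_eq_sum_partialSum_mul_sub]
    rw [sum_Icc_succ_top (by omega)] at hβ ⊢
    simp only [mul_sub, sum_sub_distrib, ← sum_mul]
    linear_combination v (m + 1) * hβ
  rw [hR, sum_sum_add_mul_sub, hβ, mul_sum, mul_sum, ← sum_add_distrib]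
  refine sum_congr rfl fun k _ => ?_
  have : ((m : ℝ) + 1) ≠ 0 := by positivity
  push_cast
  field_simp
  ring

theorem sum_natCast_mul_sub (v : ℕ → ℝ) (m : ℕ) :
    ∑ k ∈ Icc 1 m, (k : ℝ) * (v k - v (k + 1)) =
      ∑ k ∈ Icc 1 (m + 1), v k - (m + 1) * v (m + 1) := by
  have h := sum_mul_sub_eq_sum_partialSum_mul_sub (fun _ => 1) v m
  simp only [one_mul, sum_const, Nat.card_Icc, Nat.add_sub_cancel, nsmul_eq_mul, mul_one,
    sum_sub_distrib] at h
  rw [← h, sum_Icc_succ_top (by omega)]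
  ring

/-- Proposition 2(i). Suppose `B r > 0` for `1 ≤ r ≤ n − 1`. Then for
every `θ ∈ [0,1]` and any `r*` maximizing `A r θ` over `1 ≤ r ≤ n − 1`, the prize
schedule `v^{r*}` awarding `r*` equal prizes at the top attains the supremum of
`M(·,θ)` over `𝒱`, and `sup_{v ∈ 𝒱} M(v,θ) = A_{r*}(θ) = max_{1 ≤ r ≤ n−1} A_r(θ)`. -/
theorem optimal_prizes_equal_sharing
    (n : ℕ) (hn : 2 ≤ n) (β : ℕ → ℝ)
    (hβsum : ∑ r ∈ Icc 1 n, β r = 0)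
    (B : ℕ → ℝ) (hB : ∀ r, B r = ∑ k ∈ Icc 1 r, β k)
    (hBpos : ∀ r ∈ Icc 1 (n - 1), 0 < B r)
    (V : Set (ℕ → ℝ))
    (hV : V = {v | (∀ r ∈ Icc 1 (n - 1), v (r + 1) ≤ v r) ∧ (∀ r ∈ Icc 1 n, 0 ≤ v r) ∧
      ∑ r ∈ Icc 1 n, v r = 1})
    (M : (ℕ → ℝ) → ℝ → ℝ)
    (hM : ∀ v θ, M v θ = (∑ r ∈ Icc 1 n, β r * v r) +
      θ * (-(1 / (n : ℝ)) * ∑ r ∈ Icc 1 n, ∑ s ∈ Ico 1 r, (β r + β s) * (v s - v r)))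
    (A : ℕ → ℝ → ℝ)
    (hA : ∀ r θ, A r θ = (1 + θ * (2 * (r : ℝ) / n - 1)) * B r / r)
    (vs : ℕ → ℕ → ℝ)
    (hvs : ∀ s r, vs s r = if r ≤ s then 1 / (s : ℝ) else 0) :
    ∀ θ, 0 ≤ θ → θ ≤ 1 → ∀ rstar ∈ Icc 1 (n - 1),
      (∀ ρ ∈ Icc 1 (n - 1), A ρ θ ≤ A rstar θ) →
      IsGreatest ((fun v => M v θ) '' V) (A rstar θ) ∧ M (vs rstar) θ = A rstar θ := by
  obtain ⟨m, rfl⟩ : ∃ m, n = m + 1 := ⟨n - 1, by omega⟩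
  simp only [Nat.add_sub_cancel] at *
  intro θ hθ0 hθ1 t ht hmax
  obtain ⟨ht1, htm⟩ := mem_Icc.1 ht
  have ht0 : (0 : ℝ) < t := by exact_mod_cast ht1
  have hMA : ∀ v, M v θ = ∑ k ∈ Icc 1 m, A k θ * (k * (v k - v (k + 1))) := by
    intro v
    rw [hM, sum_mul_add_loss_eq β v m θ hβsum]
    refine sum_congr rfl fun k hk => ?_
    have hk0 : (k : ℝ) ≠ 0 := by
      have := (mem_Icc.1 hk).1
      positivity
    rw [hA, hB]
    field_simp
  have hAt : 0 ≤ A t θ := by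
    rw [hA]
    have hq : 0 ≤ 2 * (t : ℝ) / (m + 1 : ℕ) := by positivity
    have hc : 0 ≤ 1 + θ * (2 * (t : ℝ) / (m + 1 : ℕ) - 1) := by nlinarith
    exact div_nonneg (mul_nonneg hc (hBpos t ht).le) ht0.le
  have hMt : M (vs t) θ = A t θ := by
    rw [hMA, sum_eq_single_of_mem t ht]
    · rw [hvs, hvs, if_pos le_rfl, if_neg (by omega)]
      field_simp
      ring
    · intro k _ hkt
      rw [hvs, hvs]
      rcases lt_or_gt_of_ne hkt with h | h
      · rw [if_pos h.le, if_pos (by omega)]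
        ring
      · rw [if_neg (by omega), if_neg (by omega)]
        ring
  refine ⟨⟨⟨vs t, ?_, hMt⟩, ?_⟩, hMt⟩
  · rw [hV]
    refine ⟨fun r _ => ?_, fun r _ => ?_, ?_⟩
    · rw [hvs, hvs]
      split_ifs
      · exact le_rfl
      · omega
      · positivity
      · exact le_rfl
    · rw [hvs]
      split_ifs <;> positivity
    · simp only [hvs]
      rw [← sum_filter]
      have hf : (Icc 1 (m + 1)).filter (· ≤ t) = Icc 1 t := by
        ext r
        simp only [mem_filter, mem_Icc]
        omega
      rw [hf, sum_const, Nat.card_Icc, nsmul_eq_mul, Nat.add_sub_cancel]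
      field_simp
  · rintro _ ⟨v, hv, rfl⟩
    rw [hV] at hv
    obtain ⟨hanti, hnonneg, hsum⟩ := hv
    calc M v θ = ∑ k ∈ Icc 1 m, A k θ * (k * (v k - v (k + 1))) := hMA v
      _ ≤ ∑ k ∈ Icc 1 m, A t θ * (k * (v k - v (k + 1))) :=
        sum_le_sum fun k hk => mul_le_mul_of_nonneg_right (hmax k hk)
          (mul_nonneg k.cast_nonneg (sub_nonneg.2 (hanti k hk)))
      _ = A t θ * (1 - (m + 1) * v (m + 1)) := by
        rw [← mul_sum, sum_natCast_mul_sub, hsum]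
      _ ≤ A t θ := by
        have hlast : 0 ≤ ((m : ℝ) + 1) * v (m + 1) :=
          mul_nonneg (by positivity) (hnonneg _ (mem_Icc.2 ⟨by omega, le_rfl⟩))
        exact mul_le_of_le_one_right hAt (by linarith)
end

section
/- Suppose B_r > 0 for all 1 ≤ r ≤ n−1. For any 0 ≤ θ < θ′ ≤ 1, if r maximizes A_ρ(θ) over 1 ≤ ρ ≤ n−1 and r′ maximizes A_ρ(θ′) over 1 ≤ ρ ≤ n−1, then r ≤ r′ (the optimal number of top prizes weakly rises with loss aversion). -/
open Finset

/-- Single crossing: the weights `1 + θ * x` are strictly log-supermodular in `(θ, x)`, so a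
higher `θ` cannot reverse a preference for a higher `x`. -/
theorem le_of_one_add_mul_crossing {θ θ' x y b c : ℝ} (hθ : θ < θ') (hc : 0 < c)
    (hx : 0 < 1 + θ * x) (hx' : 0 < 1 + θ' * x)
    (h : (1 + θ * y) * c ≤ (1 + θ * x) * b)
    (h' : (1 + θ' * x) * b ≤ (1 + θ' * y) * c) : x ≤ y := by
  have key : (1 + θ * y) * (1 + θ' * x) * c ≤ (1 + θ * x) * (1 + θ' * y) * c := by
    linarith [mul_le_mul_of_nonneg_left h hx'.le, mul_le_mul_of_nonneg_left h' hx.le]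
  have cross := le_of_mul_le_mul_right key hc
  have : (θ' - θ) * (x - y) ≤ 0 := by linarith
  linarith [nonpos_of_mul_nonpos_right this (sub_pos.2 hθ)]

theorem one_add_mul_pos {θ x : ℝ} (hθ0 : 0 ≤ θ) (hθ1 : θ ≤ 1) (hx : -1 < x) :
    0 < 1 + θ * x := by
  rcases le_or_gt 0 x with h | h
  · positivity
  · nlinarith

/-- Proposition 2(ii). Suppose `B r > 0` for `1 ≤ r ≤ n − 1`. For any
`0 ≤ θ < θ' ≤ 1`, if `r` maximizes `A ρ θ` and `r'` maximizes `A ρ θ'` over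
`1 ≤ ρ ≤ n − 1`, then `r ≤ r'`: the optimal number of top prizes weakly rises with
loss aversion. -/
theorem optimal_number_of_prizes_rises_with_loss_aversion
    (n : ℕ) (hn : 2 ≤ n) (B : ℕ → ℝ)
    (hBpos : ∀ r ∈ Icc 1 (n - 1), 0 < B r)
    (A : ℕ → ℝ → ℝ)
    (hA : ∀ r θ, A r θ = (1 + θ * (2 * (r : ℝ) / n - 1)) * B r / r)
    (θ θ' : ℝ) (hθ0 : 0 ≤ θ) (hθθ' : θ < θ') (hθ'1 : θ' ≤ 1)
    (r r' : ℕ) (hr : r ∈ Icc 1 (n - 1)) (hr' : r' ∈ Icc 1 (n - 1))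
    (hmax : ∀ ρ ∈ Icc 1 (n - 1), A ρ θ ≤ A r θ)
    (hmax' : ∀ ρ ∈ Icc 1 (n - 1), A ρ θ' ≤ A r' θ') :
    r ≤ r' := by
  have hn0 : (0 : ℝ) < n := by exact_mod_cast (by lia : 0 < n)
  have hrpos : (0 : ℝ) < r := by exact_mod_cast (mem_Icc.1 hr).1
  have hr'pos : (0 : ℝ) < r' := by exact_mod_cast (mem_Icc.1 hr').1
  have hx : -1 < 2 * (r : ℝ) / n - 1 := by
    have : 0 < 2 * (r : ℝ) / n := by positivity
    linarith
  have h := hmax r' hr'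
  have h' := hmax' r hr
  simp only [hA, mul_div_assoc _ (B _)] at h h'
  have hxy := le_of_one_add_mul_crossing hθθ' (div_pos (hBpos r' hr') hr'pos)
    (one_add_mul_pos hθ0 (hθθ'.le.trans hθ'1) hx)
    (one_add_mul_pos (hθ0.trans hθθ'.le) hθ'1 hx) h h'
  rw [sub_le_sub_iff_right, div_le_div_iff_of_pos_right hn0] at hxy
  exact_mod_cast le_of_mul_le_mul_left hxy two_pos
end

section
/- Suppose B_r > 0 for all 1 ≤ r ≤ n−1, the sequence (B_r)_{r=1}^{n−1} is unimodal with mode r̂ (i.e., nondecreasing for r ≤ r̂ and nonincreasing for r ≥ r̂), the sequence (B_r/r)_{r=1}^{n−1} is unimodal with mode r₀, and r₀ ≤ r̂. Then for every θ ∈ [0,1] there exists r* with r₀ ≤ r* ≤ r̂ that maximizes A_r(θ) over 1 ≤ r ≤ n−1. -/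
open Finset

/-- Proposition 3(i). Suppose `B r > 0` for `1 ≤ r ≤ n − 1`, the
sequence `(B r)` is unimodal with mode `r̂`, the sequence `(B r / r)` is unimodal with
mode `r₀`, and `r₀ ≤ r̂`. Then for every `θ ∈ [0,1]` there exists a maximizer `r*` of
`A r θ` over `1 ≤ r ≤ n − 1` with `r₀ ≤ r* ≤ r̂`. -/
theorem optimal_prizes_between_modes
    (n : ℕ) (hn : 2 ≤ n) (B : ℕ → ℝ)
    (hBpos : ∀ r ∈ Icc 1 (n - 1), 0 < B r)
    (rhat r0 : ℕ) (hrhat : rhat ∈ Icc 1 (n - 1)) (hr0 : r0 ∈ Icc 1 (n - 1))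
    (hB_up : ∀ r s : ℕ, 1 ≤ r → r ≤ s → s ≤ rhat → B r ≤ B s)
    (hB_down : ∀ r s : ℕ, rhat ≤ r → r ≤ s → s ≤ n - 1 → B s ≤ B r)
    (hBr_up : ∀ r s : ℕ, 1 ≤ r → r ≤ s → s ≤ r0 → B r / r ≤ B s / s)
    (hBr_down : ∀ r s : ℕ, r0 ≤ r → r ≤ s → s ≤ n - 1 → B s / s ≤ B r / r)
    (hle : r0 ≤ rhat)
    (A : ℕ → ℝ → ℝ)
    (hA : ∀ r θ, A r θ = (1 + θ * (2 * (r : ℝ) / n - 1)) * B r / r) :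
    ∀ θ : ℝ, 0 ≤ θ → θ ≤ 1 → ∃ rstar, r0 ≤ rstar ∧ rstar ≤ rhat ∧
      ∀ r ∈ Icc 1 (n - 1), A r θ ≤ A rstar θ := by
  intro θ hθ0 hθ1
  simp only [mem_Icc] at hrhat hr0 ⊢
  have hsplit : ∀ r : ℕ, 1 ≤ r → A r θ = (1 - θ) * (B r / r) + 2 * θ / n * B r := by
    intro r hr
    have hr' : (r : ℝ) ≠ 0 := by positivity
    have hn' : (n : ℝ) ≠ 0 := by positivity
    rw [hA]
    field_simp
    ring
  have hmono : ∀ r s : ℕ, 1 ≤ r → 1 ≤ s → B r / r ≤ B s / s → B r ≤ B s → A r θ ≤ A s θ := by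
    intro r s hr hs hdiv hB
    rw [hsplit r hr, hsplit s hs]
    have : 0 ≤ 1 - θ := sub_nonneg.2 hθ1
    gcongr
  obtain ⟨m, hm, hmax⟩ :=
    exists_max_image (Icc r0 rhat) (fun r => A r θ) ⟨r0, mem_Icc.2 ⟨le_rfl, hle⟩⟩
  obtain ⟨hm0, hm1⟩ := mem_Icc.1 hm
  refine ⟨m, hm0, hm1, fun r hr => ?_⟩
  rcases le_total r r0 with h | h
  · exact (hmono r r0 hr.1 hr0.1 (hBr_up r r0 hr.1 h le_rfl) (hB_up r r0 hr.1 h hle)).trans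
      (hmax r0 (mem_Icc.2 ⟨le_rfl, hle⟩))
  rcases le_total r rhat with h' | h'
  · exact hmax r (mem_Icc.2 ⟨h, h'⟩)
  · exact (hmono r rhat hr.1 hrhat.1 (hBr_down rhat r hle h' hr.2)
      (hB_down rhat r le_rfl h' hr.2)).trans (hmax rhat (mem_Icc.2 ⟨hle, le_rfl⟩))
end

section
/- Suppose B_r > 0 for all 1 ≤ r ≤ n−1 and the sequence (B_r/r)_{r=1}^{n−1} is nondecreasing in r. Then for every θ ∈ [0,1], A_{n−1}(θ) ≥ A_r(θ) for all 1 ≤ r ≤ n−1; that is, maximum prize sharing (r* = n−1) is optimal for any degree of loss aversion. -/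
open Finset

/-- Proposition 3(ii). Suppose `B r > 0` for `1 ≤ r ≤ n − 1` and
`B r / r` is nondecreasing in `r`. Then for every `θ ∈ [0,1]`, `A (n−1) θ ≥ A r θ` for
all `1 ≤ r ≤ n − 1`: maximum prize sharing is optimal for any degree of loss
aversion. -/
theorem maximum_prize_sharing_optimal_DFR
    (n : ℕ) (hn : 2 ≤ n) (B : ℕ → ℝ)
    (hBpos : ∀ r ∈ Icc 1 (n - 1), 0 < B r)
    (hmono : ∀ r s : ℕ, 1 ≤ r → r ≤ s → s ≤ n - 1 → B r / r ≤ B s / s)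
    (A : ℕ → ℝ → ℝ)
    (hA : ∀ r θ, A r θ = (1 + θ * (2 * (r : ℝ) / n - 1)) * B r / r) :
    ∀ θ : ℝ, 0 ≤ θ → θ ≤ 1 → ∀ r ∈ Icc 1 (n - 1), A r θ ≤ A (n - 1) θ := by
  intro θ hθ₀ hθ₁ r hr
  have hr_pos := hBpos r hr
  obtain ⟨h1r, hrn⟩ := mem_Icc.mp hr
  have hratio := hmono r (n - 1) h1r hrn le_rfl
  have hcast : (r : ℝ) ≤ ((n - 1 : ℕ) : ℝ) := by exact_mod_cast hrn
  have hdiv : 2 * (r : ℝ) / n ≤ 2 * ((n - 1 : ℕ) : ℝ) / n := by gcongr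
  have hweight : 1 + θ * (2 * (r : ℝ) / n - 1) ≤ 1 + θ * (2 * ((n - 1 : ℕ) : ℝ) / n - 1) := by
    gcongr
  have hnonneg : 0 ≤ 1 + θ * (2 * (r : ℝ) / n - 1) := by
    have : 0 ≤ θ * (2 * (r : ℝ) / n) := by positivity
    linarith
  rw [hA, hA, mul_div_assoc _ (B r), mul_div_assoc _ (B (n - 1))]
  exact mul_le_mul hweight hratio (by positivity) (hnonneg.trans hweight)
end

section
/- Suppose B_r > 0 for all 1 ≤ r ≤ n−1, the sequence (B_r)_{r=1}^{n−1} is unimodal with mode r̂, the sequence (B_r/r)_{r=1}^{n−1} is unimodal with mode r₀, r₀ ≤ r̂, and r̂ ≤ ⌊n/2⌋. Then the function M*(θ) = max_{1 ≤ r ≤ n−1} A_r(θ) is nonincreasing on [0,1]; that is, with prizes chosen optimally, the equilibrium effort declines with loss aversion. -/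
open Finset

/-- Corollary 2(i). Suppose `B r > 0` for `1 ≤ r ≤ n − 1`, `(B r)` is
unimodal with mode `r̂`, `(B r / r)` is unimodal with mode `r₀`, `r₀ ≤ r̂`, and
`r̂ ≤ ⌊n/2⌋`. Then `M*(θ) = max_{1 ≤ r ≤ n−1} A r θ` is nonincreasing on `[0,1]`: with
prizes chosen optimally, the equilibrium effort declines with loss aversion. -/
theorem optimal_effort_declines_light_tails
    (n : ℕ) (hn : 2 ≤ n) (B : ℕ → ℝ)
    (hBpos : ∀ r ∈ Icc 1 (n - 1), 0 < B r)
    (rhat r0 : ℕ) (hrhat : rhat ∈ Icc 1 (n - 1)) (hr0 : r0 ∈ Icc 1 (n - 1))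
    (hB_up : ∀ r s : ℕ, 1 ≤ r → r ≤ s → s ≤ rhat → B r ≤ B s)
    (hB_down : ∀ r s : ℕ, rhat ≤ r → r ≤ s → s ≤ n - 1 → B s ≤ B r)
    (hBr_up : ∀ r s : ℕ, 1 ≤ r → r ≤ s → s ≤ r0 → B r / r ≤ B s / s)
    (hBr_down : ∀ r s : ℕ, r0 ≤ r → r ≤ s → s ≤ n - 1 → B s / s ≤ B r / r)
    (hle : r0 ≤ rhat) (hhalf : rhat ≤ n / 2)
    (A : ℕ → ℝ → ℝ)
    (hA : ∀ r θ, A r θ = (1 + θ * (2 * (r : ℝ) / n - 1)) * B r / r)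
    (hne : (Icc 1 (n - 1)).Nonempty)
    (Mstar : ℝ → ℝ)
    (hMstar : ∀ θ, Mstar θ = (Icc 1 (n - 1)).sup' hne fun r => A r θ) :
    AntitoneOn Mstar (Set.Icc (0 : ℝ) 1) := by
  have hn0 : (0 : ℝ) < n := by exact_mod_cast (by omega : 0 < n)
  have hsplit : ∀ r θ, 1 ≤ r → A r θ = (1 - θ) * (B r / r) + 2 * θ / n * B r := by
    intro r θ hr
    have hr' : (r : ℝ) ≠ 0 := by positivity
    rw [hA]
    field_simp
    ring
  have htail : ∀ r θ, rhat ≤ r → r ≤ n - 1 → θ ∈ Set.Icc (0 : ℝ) 1 → A r θ ≤ A rhat θ := by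
    intro r θ hr hrn hθ
    have h1 := (mem_Icc.mp hrhat).1
    rw [hsplit r θ (h1.trans hr), hsplit rhat θ h1]
    have hdiv := hBr_down rhat r hle hr hrn
    have hB := hB_down rhat r le_rfl hr hrn
    have hθ0 := hθ.1
    have hθ1 : 0 ≤ 1 - θ := sub_nonneg.mpr hθ.2
    gcongr
  have hanti : ∀ r, 1 ≤ r → r ≤ rhat → Antitone (A r) := by
    intro r hr hrr x y hxy
    have hB : 0 ≤ B r := (hBpos r (mem_Icc.mpr ⟨hr, hrr.trans (mem_Icc.mp hrhat).2⟩)).le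
    have h2r : 2 * (r : ℝ) ≤ n := by exact_mod_cast (by omega : 2 * r ≤ n)
    have hslope : 2 * (r : ℝ) / n - 1 ≤ 0 := sub_nonpos.mpr ((div_le_one hn0).mpr h2r)
    have hmul := mul_le_mul_of_nonpos_right hxy hslope
    rw [hA, hA]
    gcongr
  intro x _ y hy hxy
  rw [hMstar, hMstar]
  refine sup'_le _ _ fun r hr => ?_
  obtain ⟨hr1, hrn⟩ := mem_Icc.mp hr
  rcases le_total r rhat with h | h
  · exact (hanti r hr1 h hxy).trans (le_sup' (fun r => A r x) hr)
  · exact (htail r y h hrn hy).trans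
      ((hanti rhat (mem_Icc.mp hrhat).1 le_rfl hxy).trans (le_sup' (fun r => A r x) hrhat))
end

section
/- Suppose B_r > 0 for all 1 ≤ r ≤ n−1, the sequence (B_r)_{r=1}^{n−1} is unimodal with mode r̂, the sequence (B_r/r)_{r=1}^{n−1} is unimodal with mode r₀, r₀ ≤ r̂, and r₀ > n/2. Then the function M*(θ) = max_{1 ≤ r ≤ n−1} A_r(θ) is nondecreasing on [0,1]; that is, with prizes chosen optimally, the equilibrium effort increases with loss aversion. -/
open Finset

/-- Corollary 2(ii). Suppose `B r > 0` for `1 ≤ r ≤ n − 1`, `(B r)` is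
unimodal with mode `r̂`, `(B r / r)` is unimodal with mode `r₀`, `r₀ ≤ r̂`, and
`r₀ > n/2`. Then `M*(θ) = max_{1 ≤ r ≤ n−1} A r θ` is nondecreasing on `[0,1]`: with
prizes chosen optimally, the equilibrium effort increases with loss aversion. -/
theorem optimal_effort_increases_heavy_tails
    (n : ℕ) (hn : 2 ≤ n) (B : ℕ → ℝ)
    (hBpos : ∀ r ∈ Icc 1 (n - 1), 0 < B r)
    (rhat r0 : ℕ) (hrhat : rhat ∈ Icc 1 (n - 1)) (hr0 : r0 ∈ Icc 1 (n - 1))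
    (hB_up : ∀ r s : ℕ, 1 ≤ r → r ≤ s → s ≤ rhat → B r ≤ B s)
    (hB_down : ∀ r s : ℕ, rhat ≤ r → r ≤ s → s ≤ n - 1 → B s ≤ B r)
    (hBr_up : ∀ r s : ℕ, 1 ≤ r → r ≤ s → s ≤ r0 → B r / r ≤ B s / s)
    (hBr_down : ∀ r s : ℕ, r0 ≤ r → r ≤ s → s ≤ n - 1 → B s / s ≤ B r / r)
    (hle : r0 ≤ rhat) (hhalf : (n : ℝ) / 2 < (r0 : ℝ))
    (A : ℕ → ℝ → ℝ)
    (hA : ∀ r θ, A r θ = (1 + θ * (2 * (r : ℝ) / n - 1)) * B r / r)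
    (hne : (Icc 1 (n - 1)).Nonempty)
    (Mstar : ℝ → ℝ)
    (hMstar : ∀ θ, Mstar θ = (Icc 1 (n - 1)).sup' hne fun r => A r θ) :
    MonotoneOn Mstar (Set.Icc (0 : ℝ) 1) := by
  have hn0 : (0 : ℝ) < n := by exact_mod_cast (by lia : 0 < n)
  have hA' (r : ℕ) (θ : ℝ) : A r θ = (1 + θ * (2 * (r : ℝ) / n - 1)) * (B r / r) := by
    rw [hA, mul_div_assoc]
  have hquot_nonneg {r : ℕ} (hr : r ∈ Icc 1 (n - 1)) : 0 ≤ B r / r :=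
    div_nonneg (hBpos r hr).le r.cast_nonneg
  have hle_of_ge {r : ℕ} (hr : r ∈ Icc 1 (n - 1)) (hr0r : r0 ≤ r) {θ θ' : ℝ} (hθ : θ ≤ θ') :
      A r θ ≤ A r θ' := by
    have hcast : (r0 : ℝ) ≤ r := by exact_mod_cast hr0r
    have hslope : 0 ≤ 2 * (r : ℝ) / n - 1 := by
      rw [sub_nonneg, one_le_div hn0]
      linarith
    rw [hA', hA']
    gcongr
    exact hquot_nonneg hr
  have hle_r0 {r : ℕ} (hr : r ∈ Icc 1 (n - 1)) (hrr0 : r ≤ r0) {θ : ℝ}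
      (hθ : θ ∈ Set.Icc (0 : ℝ) 1) : A r θ ≤ A r0 θ := by
    obtain ⟨hθ0, hθ1⟩ := hθ
    have hcoef : 0 ≤ 1 + θ * (2 * (r0 : ℝ) / n - 1) := by
      have : 0 ≤ θ * (2 * (r0 : ℝ) / n) := by positivity
      linarith
    rw [hA', hA']
    refine mul_le_mul ?_ (hBr_up r r0 (mem_Icc.mp hr).1 hrr0 le_rfl) (hquot_nonneg hr) hcoef
    gcongr
  intro θ hθ θ' _ hθθ'
  rw [hMstar, hMstar]
  refine sup'_le _ _ fun r hr => ?_
  rcases le_total r0 r with h | h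
  · exact (hle_of_ge hr h hθθ').trans (le_sup' (fun r => A r θ') hr)
  · exact (hle_r0 hr h hθ).trans
      ((hle_of_ge hr0 le_rfl hθθ').trans (le_sup' (fun r => A r θ') hr0))
end

section
/- Suppose B_r > 0 for all 1 ≤ r ≤ n−1 and every maximizer of B_r over 1 ≤ r ≤ n−1 is strictly greater than n/2. Then there exists θ₀ ∈ [0,1) such that the function M*(θ) = max_{1 ≤ r ≤ n−1} A_r(θ) is strictly increasing on [θ₀,1]; that is, with prizes chosen optimally, the equilibrium effort increases with loss aversion for θ large enough. -/
open Finset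

/-- Corollary 2(iii). Suppose `B r > 0` for `1 ≤ r ≤ n − 1` and every
maximizer of `B r` over `1 ≤ r ≤ n − 1` is strictly greater than `n/2`. Then there is a
threshold `θ₀ ∈ [0,1)` such that `M*(θ) = max_{1 ≤ r ≤ n−1} A r θ` is strictly
increasing on `[θ₀,1]`: with prizes chosen optimally, the equilibrium effort increases
with loss aversion for `θ` large enough. -/
theorem optimal_effort_eventually_increases
    (n : ℕ) (hn : 2 ≤ n) (B : ℕ → ℝ)
    (hBpos : ∀ r ∈ Icc 1 (n - 1), 0 < B r)
    (hmaxhalf : ∀ r ∈ Icc 1 (n - 1), (∀ ρ ∈ Icc 1 (n - 1), B ρ ≤ B r) → (n : ℝ) / 2 < (r : ℝ))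
    (A : ℕ → ℝ → ℝ)
    (hA : ∀ r θ, A r θ = (1 + θ * (2 * (r : ℝ) / n - 1)) * B r / r)
    (hne : (Icc 1 (n - 1)).Nonempty)
    (Mstar : ℝ → ℝ)
    (hMstar : ∀ θ, Mstar θ = (Icc 1 (n - 1)).sup' hne fun r => A r θ) :
    ∃ θ₀ : ℝ, 0 ≤ θ₀ ∧ θ₀ < 1 ∧ StrictMonoOn Mstar (Set.Icc θ₀ 1) := by
  have hn0 : (0 : ℝ) < n := by exact_mod_cast (by omega : 0 < n)
  have hpos : ∀ r ∈ Icc 1 (n - 1), (0 : ℝ) < r := fun r hr => by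
    exact_mod_cast (mem_Icc.1 hr).1
  have hA1 : ∀ r ∈ Icc 1 (n - 1), A r 1 = 2 / n * B r := fun r hr => by
    have := hpos r hr
    rw [hA]
    field_simp
    ring
  obtain ⟨m, hm, hmax⟩ := exists_max_image (Icc 1 (n - 1)) B hne
  have hcont : ∀ r, Continuous (A r) := fun r => by
    rw [funext (hA r)]
    fun_prop
  have hev : ∀ᶠ θ in nhds (1 : ℝ), ∀ r ∈ Icc 1 (n - 1),
      (r : ℝ) ≤ n / 2 → A r θ < A m θ := by
    rw [Filter.eventually_all_finset]
    intro r hr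
    by_cases hle : (r : ℝ) ≤ n / 2
    · have hlt : B r < B m := by
        by_contra! h
        exact absurd (hmaxhalf r hr fun ρ hρ => (hmax ρ hρ).trans h) hle.not_gt
      have hlt1 : A r 1 < A m 1 := by
        rw [hA1 r hr, hA1 m hm]
        gcongr
      filter_upwards [(hcont r).continuousAt.eventually_lt (hcont m).continuousAt hlt1] with θ h _
      exact h
    · exact Filter.Eventually.of_forall fun _ h => absurd h hle
  obtain ⟨ε, hε, hball⟩ := Metric.eventually_nhds_iff.1 hev
  refine ⟨max 0 (1 - ε / 2), le_max_left _ _, max_lt one_pos (by linarith), ?_⟩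
  intro x hx y _ hxy
  have hxε : dist x 1 < ε := by
    rw [Real.dist_eq, abs_lt]
    constructor <;> linarith [hx.2, (le_max_right 0 (1 - ε / 2)).trans hx.1]
  obtain ⟨r, hr, hrx⟩ := exists_mem_eq_sup' hne fun r => A r x
  have hhalf : (n : ℝ) / 2 < r := by
    by_contra! h
    exact (hball hxε r hr h).not_ge (hrx ▸ le_sup' (fun r => A r x) hm)
  have hslope : 0 < 2 * (r : ℝ) / n - 1 := by
    rw [sub_pos, one_lt_div hn0]
    linarith
  have hB := hBpos r hr
  have hr0 := hpos r hr
  rw [hMstar, hMstar, hrx]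
  refine lt_of_lt_of_le ?_ (le_sup' (fun r => A r y) hr)
  simp only [hA]
  gcongr
end

section
/- Let b > 0 and let f be the uniform density on [−b/2, b/2] (f(t) = 1/b for t ∈ [−b/2, b/2] and 0 otherwise). Then β_1 = 1/b, β_n = −1/b, and β_r = 0 for all 2 ≤ r ≤ n−1; consequently B_r = 1/b for all 1 ≤ r ≤ n−1, A_r(θ) = (1−θ)/(b·r) + 2θ/(n·b), and for every θ ∈ [0,1], A_1(θ) ≥ A_r(θ) for all 1 ≤ r ≤ n−1 (the winner-take-all prize schedule is optimal for any loss aversion). -/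
open Finset MeasureTheory

/-- The distribution function of the uniform density on `[-b/2, b/2]` is affine on that interval. -/
lemma setIntegral_Iic_uniformDensity {b : ℝ} {f : ℝ → ℝ}
    (hf : ∀ t, f t = if t ∈ Set.Icc (-(b / 2)) (b / 2) then 1 / b else 0) (hb : 0 < b)
    {t : ℝ} (ht : t ∈ Set.Icc (-(b / 2)) (b / 2)) :
    ∫ u in Set.Iic t, f u = t / b + 1 / 2 := by
  have hf' : f = (Set.Icc (-(b / 2)) (b / 2)).indicator fun _ => 1 / b := by
    ext t
    simp only [hf, Set.indicator_apply]
  have hs : Set.Iic t ∩ Set.Icc (-(b / 2)) (b / 2) = Set.Icc (-(b / 2)) t := by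
    ext u
    simp only [Set.mem_inter_iff, Set.mem_Iic, Set.mem_Icc]
    exact ⟨fun h => ⟨h.2.1, h.1⟩, fun h => ⟨h.2, h.1, h.2.trans ht.2⟩⟩
  rw [hf', setIntegral_indicator measurableSet_Icc, hs, setIntegral_const, measureReal_def,
    Real.volume_Icc, ENNReal.toReal_ofReal (by linarith [ht.1]), smul_eq_mul]
  field_simp
  ring

/-- Integrating `g ∘ F` against the square of the uniform density `f` with distribution
function `F`, when `g` has an antiderivative `G`. -/
lemma integral_comp_cdf_mul_sq_uniformDensity {b : ℝ} {f F : ℝ → ℝ}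
    (hf : ∀ t, f t = if t ∈ Set.Icc (-(b / 2)) (b / 2) then 1 / b else 0) (hb : 0 < b)
    (hF : ∀ t, F t = ∫ u in Set.Iic t, f u) {g G : ℝ → ℝ}
    (hG : ∀ x, HasDerivAt G (g x) x) (hg : Continuous g) :
    ∫ t, g (F t) * f t ^ 2 = (G 1 - G 0) / b := by
  have hind : (fun t => g (F t) * f t ^ 2) =
      (Set.Icc (-(b / 2)) (b / 2)).indicator fun t => g (t / b + 1 / 2) * (1 / b) / b := by
    ext t
    by_cases ht : t ∈ Set.Icc (-(b / 2)) (b / 2)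
    · rw [Set.indicator_of_mem ht, hF, setIntegral_Iic_uniformDensity hf hb ht, hf, if_pos ht]
      ring
    · rw [Set.indicator_of_notMem ht, hf, if_neg ht]
      simp
  have hderiv : ∀ t, HasDerivAt (fun t => G (t / b + 1 / 2) / b)
      (g (t / b + 1 / 2) * (1 / b) / b) t := fun t =>
    ((hG _).comp t (((hasDerivAt_id t).div_const b).add_const (1 / 2))).div_const b
  rw [hind, integral_indicator measurableSet_Icc, integral_Icc_eq_integral_Ioc,
    ← intervalIntegral.integral_of_le (by linarith),
    intervalIntegral.integral_eq_sub_of_hasDerivAt (fun t _ => hderiv t)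
      (Continuous.intervalIntegrable (by fun_prop) _ _)]
  have h₁ : b / 2 / b + 1 / 2 = 1 := by field_simp; norm_num
  have h₀ : -(b / 2) / b + 1 / 2 = 0 := by field_simp; norm_num
  rw [h₁, h₀, sub_div]

/-- uniform noise: winner-take-all is optimal for any loss aversion.
For the uniform density on `[−b/2, b/2]`: `β 1 = 1/b`, `β n = −1/b`, `β r = 0` for
`2 ≤ r ≤ n − 1`; hence `B r = 1/b` for `1 ≤ r ≤ n − 1`,
`A r θ = (1−θ)/(b·r) + 2θ/(n·b)`, and for every `θ ∈ [0,1]`, `A 1 θ ≥ A r θ` for all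
`1 ≤ r ≤ n − 1`. -/
theorem uniform_noise_winner_take_all_optimal
    (n : ℕ) (hn : 2 ≤ n) (b : ℝ) (hb : 0 < b)
    (f : ℝ → ℝ)
    (hf : ∀ t, f t = if t ∈ Set.Icc (-(b / 2)) (b / 2) then 1 / b else 0)
    (F : ℝ → ℝ) (hF : ∀ t, F t = ∫ u in Set.Iic t, f u)
    (β : ℕ → ℝ)
    (hβ : ∀ k, 1 ≤ k → k ≤ n →
      β k = if k = 1 then ((n : ℝ) - 1) * ∫ t, F t ^ (n - 2) * f t ^ 2
        else if k = n then -(((n : ℝ) - 1) * ∫ t, (1 - F t) ^ (n - 2) * f t ^ 2)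
        else ((n - 1).choose (k - 1) : ℝ) *
          ∫ t, F t ^ (n - k - 1) * (1 - F t) ^ (k - 2) *
            (((n : ℝ) - k) - ((n : ℝ) - 1) * F t) * f t ^ 2)
    (B : ℕ → ℝ) (hB : ∀ r, B r = ∑ k ∈ Icc 1 r, β k)
    (A : ℕ → ℝ → ℝ)
    (hA : ∀ r θ, A r θ = (1 + θ * (2 * (r : ℝ) / n - 1)) * B r / r) :
    β 1 = 1 / b ∧ β n = -(1 / b) ∧ (∀ r ∈ Icc 2 (n - 1), β r = 0) ∧
      (∀ r ∈ Icc 1 (n - 1), B r = 1 / b) ∧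
      (∀ r ∈ Icc 1 (n - 1), ∀ θ : ℝ,
        A r θ = (1 - θ) / (b * r) + 2 * θ / (n * b)) ∧
      (∀ θ : ℝ, 0 ≤ θ → θ ≤ 1 → ∀ r ∈ Icc 1 (n - 1), A r θ ≤ A 1 θ) := by
  have hn0 : (n : ℝ) ≠ 0 := by positivity
  have hcast : ((n - 1 : ℕ) : ℝ) = (n : ℝ) - 1 := by rw [Nat.cast_sub (by omega), Nat.cast_one]
  have hpow : n - 1 - 1 = n - 2 := by omega
  have hpos : n - 1 ≠ 0 := by omega
  have hβ1 : β 1 = 1 / b := by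
    have hG : ∀ x : ℝ, HasDerivAt (fun x => x ^ (n - 1)) (((n : ℝ) - 1) * x ^ (n - 2)) x := by
      intro x
      simpa only [hcast, hpow] using hasDerivAt_pow (n - 1) x
    have h := integral_comp_cdf_mul_sq_uniformDensity hf hb hF hG (by fun_prop)
    simp only [mul_assoc, integral_const_mul] at h
    rw [hβ 1 le_rfl (by omega), if_pos rfl, h]
    simp [hpos]
  have hβn : β n = -(1 / b) := by
    have hG : ∀ x : ℝ, HasDerivAt (fun x => -(1 - x) ^ (n - 1))
        (((n : ℝ) - 1) * (1 - x) ^ (n - 2)) x := by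
      intro x
      refine (((hasDerivAt_id x).const_sub 1).pow (n - 1)).neg.congr_deriv ?_
      simp only [hcast, hpow, id]
      ring
    have h := integral_comp_cdf_mul_sq_uniformDensity hf hb hF hG (by fun_prop)
    simp only [mul_assoc, integral_const_mul] at h
    rw [hβ n (by omega) le_rfl, if_neg (by omega), if_pos rfl, h]
    simp [hpos]
  have hβmid : ∀ r ∈ Icc 2 (n - 1), β r = 0 := by
    intro r hr
    rw [mem_Icc] at hr
    obtain ⟨k, rfl⟩ := Nat.exists_eq_add_of_le hr.1
    obtain ⟨m, rfl⟩ := Nat.exists_eq_add_of_le (show 2 + k + 1 ≤ n by omega)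
    have e₁ : 2 + k + 1 + m - (2 + k) - 1 = m := by omega
    have e₂ : 2 + k - 2 = k := by omega
    have hG : ∀ x : ℝ, HasDerivAt (fun x => x ^ (m + 1) * (1 - x) ^ (k + 1))
        (x ^ m * (1 - x) ^ k * (((2 + k + 1 + m : ℕ) - (2 + k : ℕ) : ℝ) -
          ((2 + k + 1 + m : ℕ) - 1 : ℝ) * x)) x := by
      intro x
      refine ((hasDerivAt_pow (m + 1) x).mul
        (((hasDerivAt_id x).const_sub 1).pow (k + 1))).congr_deriv ?_
      simp only [id, Nat.add_sub_cancel, Pi.pow_apply]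
      push_cast
      ring
    have h := integral_comp_cdf_mul_sq_uniformDensity hf hb hF hG (by fun_prop)
    rw [hβ _ (by omega) (by omega), if_neg (by omega), if_neg (by omega), e₁, e₂, h]
    simp
  have hBr : ∀ r ∈ Icc 1 (n - 1), B r = 1 / b := by
    intro r hr
    rw [mem_Icc] at hr
    rw [hB, sum_eq_single_of_mem 1 (mem_Icc.2 ⟨le_rfl, hr.1⟩), hβ1]
    intro k hk hk1
    rw [mem_Icc] at hk
    exact hβmid k (mem_Icc.2 (by omega))
  have hAr : ∀ r ∈ Icc 1 (n - 1), ∀ θ : ℝ,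
      A r θ = (1 - θ) / (b * r) + 2 * θ / (n * b) := by
    intro r hr θ
    have hr0 : (r : ℝ) ≠ 0 := Nat.cast_ne_zero.2 (by have := (mem_Icc.1 hr).1; omega)
    rw [hA, hBr r hr]
    field_simp
    ring
  refine ⟨hβ1, hβn, hβmid, hBr, hAr, fun θ _ hθ r hr => ?_⟩
  have hr1 : (1 : ℝ) ≤ r := Nat.one_le_cast.2 (mem_Icc.1 hr).1
  rw [hAr r hr, hAr 1 (mem_Icc.2 (by omega)), Nat.cast_one]
  have : 0 ≤ 1 - θ := sub_nonneg.2 hθ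
  gcongr
end

section
/- Let f be the Pareto density f(t) = 1/t² for t ≥ 1 and 0 otherwise, with cumulative distribution function F(t) = 1 − 1/t on [1,∞). Then for every 1 ≤ r ≤ n−1, B_r = r(r+1)/(n(n+1)). In particular, B_r/r = (r+1)/(n(n+1)) is positive and increasing in r. -/
open Finset MeasureTheory

/-- The substitution `u = 1 / t` turns this into the Beta integral `∫₀¹ (1 - u) ^ a * u ^ m`. -/
theorem integrableOn_and_integral_Ioi_one_sub_inv_pow_mul_inv_pow (a m : ℕ) :
    IntegrableOn (fun t : ℝ => (1 - t⁻¹) ^ a * t⁻¹ ^ (m + 2)) (Set.Ioi 1) ∧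
      ∫ t in Set.Ioi (1 : ℝ), (1 - t⁻¹) ^ a * t⁻¹ ^ (m + 2) =
        (a.factorial : ℝ) * m.factorial / (a + m + 1).factorial := by
  induction a generalizing m with
  | zero =>
    have hlt : (-((m + 2 : ℕ) : ℝ)) < -1 := by
      push_cast
      linarith [m.cast_nonneg (α := ℝ)]
    have heq : Set.EqOn (fun t : ℝ => t ^ (-((m + 2 : ℕ) : ℝ)))
        (fun t : ℝ => (1 - t⁻¹) ^ 0 * t⁻¹ ^ (m + 2)) (Set.Ioi 1) := by
      intro t ht
      have ht0 : (0 : ℝ) ≤ t := zero_le_one.trans (le_of_lt ht)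
      simp only [Real.rpow_neg ht0, Real.rpow_natCast, pow_zero, one_mul, inv_pow]
    refine ⟨(integrableOn_Ioi_rpow_of_lt hlt one_pos).congr_fun heq measurableSet_Ioi, ?_⟩
    rw [← setIntegral_congr_fun measurableSet_Ioi heq, integral_Ioi_rpow_of_lt hlt one_pos]
    have hm : (m : ℝ) + 1 ≠ 0 := by positivity
    have hm' : -((m : ℝ) + 2) + 1 ≠ 0 := by
      intro h
      apply hm
      linarith
    have hfac : (m.factorial : ℝ) ≠ 0 := by positivity
    simp only [Real.one_rpow, zero_add, Nat.factorial_succ, Nat.factorial_zero]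
    push_cast
    field_simp
    ring
  | succ a ih =>
    obtain ⟨h₁, e₁⟩ := ih m
    obtain ⟨h₂, e₂⟩ := ih (m + 1)
    have heq : (fun t : ℝ => (1 - t⁻¹) ^ (a + 1) * t⁻¹ ^ (m + 2)) = fun t =>
        (1 - t⁻¹) ^ a * t⁻¹ ^ (m + 2) - (1 - t⁻¹) ^ a * t⁻¹ ^ (m + 1 + 2) := by
      funext t
      ring
    rw [heq]
    refine ⟨h₁.sub h₂, ?_⟩
    rw [integral_sub h₁ h₂, e₁, e₂, show a + (m + 1) + 1 = a + m + 1 + 1 by ring,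
      show a + 1 + m + 1 = a + m + 1 + 1 by ring]
    have hfac : ((a + m + 1).factorial : ℝ) ≠ 0 := by positivity
    rw [Nat.factorial_succ (a + m + 1), Nat.factorial_succ m, Nat.factorial_succ a]
    push_cast
    field_simp
    ring

/-- Pareto noise. For the Pareto density `f(t) = 1/t²` on `[1,∞)`
with cdf `F(t) = 1 − 1/t`, the cumulative coefficients satisfy
`B_r = r(r+1)/(n(n+1))` for every `1 ≤ r ≤ n − 1`. In particular,
`B_r/r = (r+1)/(n(n+1))` is positive and increasing in `r`. -/
theorem pareto_noise_cumulative_coefficients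
    (n : ℕ) (hn : 2 ≤ n)
    (f : ℝ → ℝ) (hf : ∀ t, f t = if (1 : ℝ) ≤ t then 1 / t ^ 2 else 0)
    (F : ℝ → ℝ) (hF : ∀ t, F t = if (1 : ℝ) ≤ t then 1 - 1 / t else 0)
    (B : ℕ → ℝ)
    (hB : ∀ r ∈ Icc 1 (n - 1),
      B r = (r : ℝ) * ((n - 1).choose r : ℝ) *
        ∫ t, F t ^ (n - 1 - r) * (1 - F t) ^ (r - 1) * f t ^ 2) :
    (∀ r ∈ Icc 1 (n - 1), B r = (r : ℝ) * ((r : ℝ) + 1) / ((n : ℝ) * ((n : ℝ) + 1))) ∧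
      (∀ r ∈ Icc 1 (n - 1),
        B r / r = ((r : ℝ) + 1) / ((n : ℝ) * ((n : ℝ) + 1)) ∧ 0 < B r / r) ∧
      (∀ r ∈ Icc 1 (n - 1), ∀ s ∈ Icc 1 (n - 1), r < s → B r / r < B s / s) := by
  have hval : ∀ r ∈ Icc 1 (n - 1),
      B r = (r : ℝ) * ((r : ℝ) + 1) / ((n : ℝ) * ((n : ℝ) + 1)) := by
    intro r hr
    rw [hB r hr]
    obtain ⟨hr1, hrn⟩ := mem_Icc.mp hr
    obtain ⟨k, rfl⟩ : ∃ k, n = k + r + 1 := ⟨n - 1 - r, by omega⟩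
    obtain ⟨q, rfl⟩ : ∃ q, r = q + 1 := ⟨r - 1, by omega⟩
    have hind : (fun t => F t ^ k * (1 - F t) ^ q * f t ^ 2) =
        (Set.Ici (1 : ℝ)).indicator
          (fun t => (1 - t⁻¹) ^ k * t⁻¹ ^ (q + 2 + 2)) := by
      funext t
      by_cases ht : (1 : ℝ) ≤ t
      · simp only [hf, hF, Set.indicator, Set.mem_Ici, if_pos ht, one_div]
        ring
      · simp [hf, ht]
    simp only [Nat.add_sub_cancel]
    rw [hind, integral_indicator measurableSet_Ici, integral_Ici_eq_integral_Ioi,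
      (integrableOn_and_integral_Ioi_one_sub_inv_pow_mul_inv_pow k (q + 2)).2]
    have hchoose : ((k + (q + 1)).choose (q + 1) : ℝ) * k.factorial * (q + 1).factorial =
        (k + (q + 1)).factorial := by
      exact_mod_cast (by
        rw [mul_right_comm]
        simpa using Nat.choose_mul_factorial_mul_factorial (Nat.le_add_left (q + 1) k))
    have hsucc : ((k + (q + 2) + 1).factorial : ℝ) =
        (k + q + 3) * ((k + q + 2) * (k + (q + 1)).factorial) := by
      rw [show k + (q + 2) + 1 = k + (q + 1) + 1 + 1 by ring, Nat.factorial_succ,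
        Nat.factorial_succ]
      push_cast
      ring
    have hchoose_ne : ((k + (q + 1)).choose (q + 1) : ℝ) ≠ 0 :=
      Nat.cast_ne_zero.mpr (Nat.choose_pos (Nat.le_add_left _ _)).ne'
    rw [hsucc, ← hchoose, Nat.factorial_succ (q + 1)]
    push_cast
    field_simp
    ring
  have hn0 : (0 : ℝ) < n := by
    exact_mod_cast (by omega : 0 < n)
  have hdiv : ∀ r ∈ Icc 1 (n - 1),
      B r / r = ((r : ℝ) + 1) / ((n : ℝ) * ((n : ℝ) + 1)) := by
    intro r hr
    have hr0 : (r : ℝ) ≠ 0 := Nat.cast_ne_zero.mpr (by have := (mem_Icc.mp hr).1; omega)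
    rw [hval r hr]
    field_simp
  refine ⟨hval, fun r hr => ⟨hdiv r hr, ?_⟩, fun r hr s hs hrs => ?_⟩
  · rw [hdiv r hr]
    positivity
  · rw [hdiv r hr, hdiv s hs]
    gcongr
end

section
/- Let f be the Burr density f(t) = 2t/(1+t²)² for t ≥ 0 and 0 otherwise, with cumulative distribution function F(t) = 1 − 1/(1+t²) on [0,∞). Then for every 1 ≤ r ≤ n−1, B_r = π(n−r)r(r+1)/(2^{2n−1}·n(n+1))·C(2n−2r−1, n−r)·C(2r+1, r). -/
open Finset MeasureTheory

/-- The integrand of the beta-type integral `∫₀^∞ t ^ (2 p) / (1 + t²) ^ (p + q + 1) dt`. -/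
noncomputable def betaIntegrand (p q : ℕ) (t : ℝ) : ℝ :=
  t ^ (2 * p) / (1 + t ^ 2) ^ (p + q + 1)

lemma betaIntegrand_nonneg (p q : ℕ) (t : ℝ) : 0 ≤ betaIntegrand p q t := by
  unfold betaIntegrand
  rw [pow_mul]
  positivity

lemma betaIntegrand_le (p q : ℕ) (t : ℝ) : betaIntegrand p q t ≤ (1 + t ^ 2)⁻¹ := by
  unfold betaIntegrand
  rw [inv_eq_one_div, div_le_div_iff₀ (by positivity) (by positivity), one_mul, pow_succ _ (p + q)]
  gcongr
  rw [pow_mul, pow_add]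
  calc (t ^ 2) ^ p ≤ (1 + t ^ 2) ^ p := by gcongr; linarith
    _ ≤ (1 + t ^ 2) ^ p * (1 + t ^ 2) ^ q :=
      le_mul_of_one_le_right (by positivity) (one_le_pow₀ (by nlinarith [sq_nonneg t]))

lemma integrable_betaIntegrand (p q : ℕ) : Integrable (betaIntegrand p q) := by
  refine integrable_inv_one_add_sq.mono' ?_ (ae_of_all _ fun t => ?_)
  · refine Continuous.aestronglyMeasurable ?_
    unfold betaIntegrand
    exact (continuous_id.pow _).div (by fun_prop) fun t => by positivity
  · rw [Real.norm_of_nonneg (betaIntegrand_nonneg p q t)]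
    exact betaIntegrand_le p q t

lemma betaIntegrand_succ_add_succ (p q : ℕ) (t : ℝ) :
    betaIntegrand p (q + 1) t + betaIntegrand (p + 1) q t = betaIntegrand p q t := by
  have h : (1 + t ^ 2 : ℝ) ≠ 0 := by positivity
  unfold betaIntegrand
  rw [show p + 1 + q + 1 = p + q + 1 + 1 by ring, show p + (q + 1) + 1 = p + q + 1 + 1 by ring]
  field_simp
  ring

lemma hasDerivAt_mul_betaIntegrand (p q : ℕ) (t : ℝ) :
    HasDerivAt (fun t => t * betaIntegrand p q t)
      ((2 * p + 1) * betaIntegrand p (q + 1) t - (2 * q + 1) * betaIntegrand (p + 1) q t) t := by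
  have h : (1 + t ^ 2 : ℝ) ≠ 0 := by positivity
  have hd : HasDerivAt (fun t : ℝ => t ^ (2 * p + 1) / (1 + t ^ 2) ^ (p + q + 1)) _ t :=
    (hasDerivAt_pow (2 * p + 1) t).div
      (((hasDerivAt_pow 2 t).const_add 1).pow (p + q + 1)) (pow_ne_zero _ h)
  convert hd using 1
  · ext s
    unfold betaIntegrand
    ring
  · unfold betaIntegrand
    rw [show p + 1 + q + 1 = p + q + 1 + 1 by ring, show p + (q + 1) + 1 = p + q + 1 + 1 by ring]
    simp only [Nat.add_sub_cancel]
    push_cast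
    field_simp
    ring

lemma tendsto_mul_betaIntegrand (p q : ℕ) :
    Filter.Tendsto (fun t => t * betaIntegrand p q t) Filter.atTop (nhds 0) := by
  refine squeeze_zero' ?_ ?_ tendsto_inv_atTop_zero
  · filter_upwards [Filter.eventually_ge_atTop 0] with t ht
    exact mul_nonneg ht (betaIntegrand_nonneg p q t)
  · filter_upwards [Filter.eventually_gt_atTop 0] with t ht
    calc t * betaIntegrand p q t ≤ t * (1 + t ^ 2)⁻¹ := by
          gcongr
          exact betaIntegrand_le p q t
      _ ≤ t⁻¹ := by
          rw [← div_eq_mul_inv, inv_eq_one_div, div_le_div_iff₀ (by positivity) ht]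
          nlinarith

lemma integral_betaIntegrand_succ_add_succ (p q : ℕ) :
    (∫ t in Set.Ioi 0, betaIntegrand p (q + 1) t) + ∫ t in Set.Ioi 0, betaIntegrand (p + 1) q t =
      ∫ t in Set.Ioi 0, betaIntegrand p q t := by
  rw [← integral_add (integrable_betaIntegrand _ _).integrableOn
    (integrable_betaIntegrand _ _).integrableOn]
  simp_rw [betaIntegrand_succ_add_succ]

lemma integral_betaIntegrand_by_parts (p q : ℕ) :
    (2 * p + 1) * (∫ t in Set.Ioi 0, betaIntegrand p (q + 1) t) =
      (2 * q + 1) * ∫ t in Set.Ioi 0, betaIntegrand (p + 1) q t := by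
  have h₁ := ((integrable_betaIntegrand p (q + 1)).const_mul (2 * (p : ℝ) + 1)).integrableOn
    (s := Set.Ioi 0)
  have h₂ := ((integrable_betaIntegrand (p + 1) q).const_mul (2 * (q : ℝ) + 1)).integrableOn
    (s := Set.Ioi 0)
  have h := integral_Ioi_of_hasDerivAt_of_tendsto' (a := 0)
    (fun t _ => hasDerivAt_mul_betaIntegrand p q t) (h₁.sub h₂) (tendsto_mul_betaIntegrand p q)
  rw [integral_sub h₁ h₂, integral_const_mul, integral_const_mul] at h
  linarith

lemma integral_betaIntegrand_zero_right (p : ℕ) :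
    ∫ t in Set.Ioi 0, betaIntegrand p 0 t =
      Real.pi / 2 * (2 * p).factorial / (4 ^ p * p.factorial * p.factorial) := by
  induction p with
  | zero =>
    simp [betaIntegrand]
  | succ p ih =>
    have h₁ := integral_betaIntegrand_succ_add_succ p 0
    have h₂ := integral_betaIntegrand_by_parts p 0
    have h₃ : ∫ t in Set.Ioi 0, betaIntegrand (p + 1) 0 t =
        (2 * p + 1) / (2 * (p + 1)) * ∫ t in Set.Ioi 0, betaIntegrand p 0 t := by
      field_simp
      rw [← h₁]
      push_cast at h₂
      linarith
    rw [h₃, ih, show 2 * (p + 1) = 2 * p + 1 + 1 by ring]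
    simp only [Nat.factorial_succ]
    push_cast
    field_simp
    ring

lemma integral_betaIntegrand (p q : ℕ) :
    ∫ t in Set.Ioi 0, betaIntegrand p q t =
      Real.pi / 2 * (2 * p).factorial * (2 * q).factorial /
        (4 ^ (p + q) * p.factorial * q.factorial * (p + q).factorial) := by
  induction q with
  | zero =>
    rw [integral_betaIntegrand_zero_right]
    simp
  | succ q ih =>
    have h₁ := integral_betaIntegrand_succ_add_succ p q
    have h₂ := integral_betaIntegrand_by_parts p q
    have h₃ : ∫ t in Set.Ioi 0, betaIntegrand p (q + 1) t =
        (2 * q + 1) / (2 * (p + q + 1)) * ∫ t in Set.Ioi 0, betaIntegrand p q t := by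
      field_simp
      rw [← h₁]
      linarith
    rw [h₃, ih, show 2 * (q + 1) = 2 * q + 1 + 1 by ring, ← add_assoc p q 1]
    simp only [Nat.factorial_succ]
    push_cast
    field_simp
    ring

/-- Burr noise. For the Burr density `f(t) = 2t/(1+t²)²` on `[0,∞)`
with cdf `F(t) = 1 − 1/(1+t²)`, the cumulative coefficients satisfy
`B_r = π(n−r)r(r+1)/(2^{2n−1} n(n+1)) · C(2n−2r−1, n−r) · C(2r+1, r)` for every
`1 ≤ r ≤ n − 1`. -/
theorem burr_noise_cumulative_coefficients
    (n : ℕ) (hn : 2 ≤ n)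
    (f : ℝ → ℝ) (hf : ∀ t, f t = if (0 : ℝ) ≤ t then 2 * t / (1 + t ^ 2) ^ 2 else 0)
    (F : ℝ → ℝ) (hF : ∀ t, F t = if (0 : ℝ) ≤ t then 1 - 1 / (1 + t ^ 2) else 0)
    (B : ℕ → ℝ)
    (hB : ∀ r ∈ Icc 1 (n - 1),
      B r = (r : ℝ) * ((n - 1).choose r : ℝ) *
        ∫ t, F t ^ (n - 1 - r) * (1 - F t) ^ (r - 1) * f t ^ 2) :
    ∀ r ∈ Icc 1 (n - 1),
      B r = Real.pi * ((n : ℝ) - r) * r * ((r : ℝ) + 1) /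
          (2 ^ (2 * n - 1) * (n : ℝ) * ((n : ℝ) + 1)) *
        ((2 * n - 2 * r - 1).choose (n - r) : ℝ) * ((2 * r + 1).choose r : ℝ) := by
  intro r hr
  rw [hB r hr]
  obtain ⟨hr₁, hr₂⟩ := mem_Icc.mp hr
  obtain ⟨m, rfl⟩ : ∃ m, r = m + 1 := ⟨r - 1, by omega⟩
  obtain ⟨k, rfl⟩ : ∃ k, n = k + m + 2 := ⟨n - m - 2, by omega⟩
  have hint : ∫ t, F t ^ (k + m + 2 - 1 - (m + 1)) * (1 - F t) ^ (m + 1 - 1) * f t ^ 2 =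
      4 * ∫ t in Set.Ioi 0, betaIntegrand (k + 1) (m + 2) t := by
    rw [← integral_const_mul, ← integral_indicator measurableSet_Ioi]
    refine integral_congr_ae (ae_of_all _ fun t => ?_)
    simp only [show k + m + 2 - 1 - (m + 1) = k by omega, Nat.add_sub_cancel]
    rcases lt_trichotomy t 0 with ht | rfl | ht
    · simp [hf, ht.not_ge, ht.le]
    · simp [hf]
    · have h : (1 + t ^ 2 : ℝ) ≠ 0 := by positivity
      have hF' : F t = t ^ 2 / (1 + t ^ 2) := by
        rw [hF, if_pos ht.le]
        field_simp
        ring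
      have hF'' : 1 - F t = 1 / (1 + t ^ 2) := by
        rw [hF, if_pos ht.le]
        ring
      rw [Set.indicator_of_mem (Set.mem_Ioi.mpr ht), hF'', hF', hf, if_pos ht.le]
      unfold betaIntegrand
      rw [show k + 1 + (m + 2) + 1 = k + m + 4 by ring]
      simp only [div_pow, one_pow, mul_pow]
      field_simp
      ring
  rw [hint, integral_betaIntegrand, show k + m + 2 - 1 = k + (m + 1) by omega,
    show 2 * (k + m + 2) - 2 * (m + 1) - 1 = k + (k + 1) by omega,
    show k + m + 2 - (m + 1) = k + 1 by omega,
    show 2 * (m + 1) + 1 = (m + 2) + (m + 1) by ring,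
    show 2 * (k + m + 2) - 1 = 2 * (k + m) + 3 by omega,
    Nat.cast_choose ℝ (Nat.le_add_left (m + 1) k), Nat.cast_choose ℝ (Nat.le_add_left (k + 1) k),
    Nat.cast_choose ℝ (Nat.le_add_left (m + 1) (m + 2))]
  simp only [Nat.add_sub_cancel]
  rw [show 2 * (k + 1) = k + (k + 1) + 1 by ring, show 2 * (m + 2) = m + 2 + (m + 1) + 1 by ring,
    show k + 1 + (m + 2) = k + (m + 1) + 1 + 1 by ring,
    Nat.factorial_succ (k + (k + 1)), Nat.factorial_succ (m + 2 + (m + 1)),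
    Nat.factorial_succ (k + (m + 1) + 1), Nat.factorial_succ (k + (m + 1)),
    Nat.factorial_succ (m + 1), Nat.factorial_succ m, Nat.factorial_succ k,
    show (4 : ℝ) = 2 ^ 2 by norm_num, ← pow_mul]
  push_cast
  field_simp
  ring
end

section
/- Suppose the probability density f is symmetric, i.e., f(−t) = f(t) for all t ∈ ℝ. Then B_r = B_{n−r} for every 1 ≤ r ≤ n−1, and consequently Σ_{r=1}^{n−1} (2r/n − 1)·B_r = 0; hence, for the equidistant prize schedule v with v_r = 2(n−r)/(n(n−1)) (whose prize differentials are constant, d_r = 2/(n(n−1))), the psychological marginal benefit satisfies L(v) = Σ_{r=1}^{n−1} (2r/n − 1)·B_r·d_r = 0, so the equilibrium effort is unaffected by loss aversion. -/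
open Finset MeasureTheory

/-- The distribution function of a symmetric density satisfies `F (-t) = 1 - F t`. -/
theorem setIntegral_Iic_neg_of_even {f : ℝ → ℝ} (hfint : Integrable f)
    (hf1 : (∫ t, f t) = 1) (hsymm : ∀ t : ℝ, f (-t) = f t) (t : ℝ) :
    ∫ u in Set.Iic (-t), f u = 1 - ∫ u in Set.Iic t, f u := by
  have hneg : ∫ u in Set.Iic (-t), f u = ∫ u in Set.Ioi t, f u := by
    simpa [hsymm] using integral_comp_neg_Iic (-t) f
  have hadd := intervalIntegral.integral_Iic_add_Ioi (b := t)
    hfint.integrableOn hfint.integrableOn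
  linarith

theorem mul_choose_pred_symm {n r : ℕ} (h1 : 1 ≤ r) (hr : r < n) :
    r * (n - 1).choose r = (n - r) * (n - 1).choose (n - r) := by
  obtain ⟨a, rfl⟩ := Nat.exists_eq_add_of_le' h1
  have hc : (n - 1).choose (n - (a + 1)) = (n - 1).choose a :=
    Nat.choose_symm_of_eq_add (by omega)
  have hs := Nat.choose_succ_right_eq (n - 1) a
  rw [hc, mul_comm, hs, mul_comm]
  congr 1
  omega

theorem sum_Icc_eq_zero_of_reflect_neg {n : ℕ} {g : ℕ → ℝ}
    (hg : ∀ r ∈ Icc 1 (n - 1), g (n - r) = -g r) :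
    ∑ r ∈ Icc 1 (n - 1), g r = 0 := by
  have hreflect : ∑ r ∈ Icc 1 (n - 1), g r = ∑ r ∈ Icc 1 (n - 1), g (n - r) := by
    refine sum_nbij' (fun r => n - r) (fun r => n - r) ?_ ?_ ?_ ?_ ?_ <;>
      intro r hr <;> have hr' := mem_Icc.mp hr
    · exact mem_Icc.mpr (by omega)
    · exact mem_Icc.mpr (by omega)
    · show n - (n - r) = r
      omega
    · show n - (n - r) = r
      omega
    · show g r = g (n - (n - r))
      rw [Nat.sub_sub_self (by omega)]
  rw [sum_congr rfl hg, sum_neg_distrib] at hreflect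
  linarith

/-- symmetric noise and equidistant prizes. If the density `f` is
symmetric (`f(−t) = f(t)`), then `B_r = B_{n−r}` for every `1 ≤ r ≤ n − 1`, hence
`∑_{r=1}^{n−1} (2r/n − 1) B_r = 0`; therefore the equidistant prize schedule
`v_r = 2(n−r)/(n(n−1))` has `L(v) = ∑_{r=1}^{n−1} (2r/n − 1) B_r d_r = 0`, so the
equilibrium effort is unaffected by loss aversion. -/
theorem symmetric_noise_equidistant_prizes
    (n : ℕ) (hn : 2 ≤ n)
    (f : ℝ → ℝ) (hf0 : ∀ t, 0 ≤ f t) (hfint : Integrable f)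
    (hf1 : (∫ t, f t) = 1)
    (hsymm : ∀ t : ℝ, f (-t) = f t)
    (F : ℝ → ℝ) (hF : ∀ t, F t = ∫ u in Set.Iic t, f u)
    (B : ℕ → ℝ)
    (hB : ∀ r ∈ Icc 1 (n - 1),
      B r = (r : ℝ) * ((n - 1).choose r : ℝ) *
        ∫ t, F t ^ (n - 1 - r) * (1 - F t) ^ (r - 1) * f t ^ 2)
    (v : ℕ → ℝ)
    (hv : ∀ r, v r = 2 * ((n : ℝ) - r) / ((n : ℝ) * ((n : ℝ) - 1))) :
    (∀ r ∈ Icc 1 (n - 1), B r = B (n - r)) ∧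
      (∑ r ∈ Icc 1 (n - 1), (2 * (r : ℝ) / n - 1) * B r = 0) ∧
      (∑ r ∈ Icc 1 (n - 1), (2 * (r : ℝ) / n - 1) * B r * (v r - v (r + 1)) = 0) := by
  have hFneg (t : ℝ) : F (-t) = 1 - F t := by
    rw [hF, hF, setIntegral_Iic_neg_of_even hfint hf1 hsymm]
  have hBsymm : ∀ r ∈ Icc 1 (n - 1), B r = B (n - r) := by
    intro r hr
    have hr' := mem_Icc.mp hr
    rw [hB r hr, hB (n - r) (mem_Icc.mpr (by omega))]
    congr 1
    · exact_mod_cast mul_choose_pred_symm hr'.1 (by omega)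
    · rw [← integral_neg_eq_self]
      refine integral_congr_ae (.of_forall fun t => ?_)
      have hexp : n - 1 - (n - r) = r - 1 := by omega
      have hexp' : n - r - 1 = n - 1 - r := by omega
      simp only [hFneg, hsymm, hexp, hexp', sub_sub_cancel]
      ring
  have hsum : ∑ r ∈ Icc 1 (n - 1), (2 * (r : ℝ) / n - 1) * B r = 0 := by
    refine sum_Icc_eq_zero_of_reflect_neg fun r hr => ?_
    have hr' := mem_Icc.mp hr
    have hn0 : (n : ℝ) ≠ 0 := by exact_mod_cast (by omega : n ≠ 0)
    rw [← hBsymm r hr, Nat.cast_sub (by omega)]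
    field_simp
    ring
  refine ⟨hBsymm, hsum, ?_⟩
  have hd (r : ℕ) : v r - v (r + 1) = 2 / ((n : ℝ) * ((n : ℝ) - 1)) := by
    rw [hv, hv, ← sub_div]
    push_cast
    ring
  simp only [hd, ← sum_mul, hsum, zero_mul]
end
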